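/- Let C_m = max{1, C₁, 4πC₂}, fix C₀ with 0 < C₀ ≤ min{1/4, 1/(C_m · 8^(1/(q+1)))}, and set σ* = C₀ · R₀^(1 + (2q+1)/(q(q+1))), γ* = σ*/(2(R₀ + σ*)), κ = 9 · 4^q/(C₁ · C₀^q) and Γ = max{C₀, κ}. There exists δ₀ > 0, depending only on L₀, C₁, C₂, q and C₀, such that every reduced static shell with inner radius R₀ ≤ δ₀ satisfying R₀^(1/(q+1)) · Γ ≤ 1 admits a point r₂ with R₀ + σ* < r₂ < R₀ + σ* + κ · R₀^((q+2)/(q+1)), γ(r₂) = γ*, and γ(r) ≥ γ* for all r ∈ [R₀ + σ*, r₂]. -/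

import Mathlib

open Real MeasureTheory

noncomputable section

/-- `γ(r) = -μ(r) - (1/2)·log(1 + L₀/r²)`. -/
def gam (L₀ : ℝ) (μ : ℝ → ℝ) (r : ℝ) : ℝ :=
  -μ r - (1 / 2) * Real.log (1 + L₀ / r ^ 2)

/-- Energy density `ρ(r) = C₁·max(γ(r),0)^q / r⁴`. -/
def rho (L₀ C₁ q : ℝ) (μ : ℝ → ℝ) (r : ℝ) : ℝ :=
  C₁ * (max (gam L₀ μ r) 0) ^ q / r ^ 4

/-- Radial pressure `p(r) = C₂·max(γ(r),0)^(q+1) / r⁴`. -/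
def pres (L₀ C₂ q : ℝ) (μ : ℝ → ℝ) (r : ℝ) : ℝ :=
  C₂ * (max (gam L₀ μ r) 0) ^ (q + 1) / r ^ 4

/-- `z(r) = C₃·max(γ(r),0)^q / r²`. -/
def zfun (L₀ C₃ q : ℝ) (μ : ℝ → ℝ) (r : ℝ) : ℝ :=
  C₃ * (max (gam L₀ μ r) 0) ^ q / r ^ 2

/-- Quasi-local mass `m(r) = ∫_{R₀}^r 4π η² ρ(η) dη`. -/
def mass (R₀ L₀ C₁ q : ℝ) (μ : ℝ → ℝ) (r : ℝ) : ℝ :=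
  ∫ η in R₀..r, 4 * π * η ^ 2 * rho L₀ C₁ q μ η

/-- `μ'(r) = (m/r² + 4πrp)·e^{2λ}` with `e^{-2λ} = 1 - 2m/r`. -/
def muder (R₀ L₀ C₁ C₂ q : ℝ) (μ : ℝ → ℝ) (r : ℝ) : ℝ :=
  (mass R₀ L₀ C₁ q μ r / r ^ 2 + 4 * π * r * pres L₀ C₂ q μ r) *
    (1 - 2 * mass R₀ L₀ C₁ q μ r / r)⁻¹

/-- `γ'(r) = -μ'(r) + L₀/(r(r²+L₀))`. -/
def gamder (R₀ L₀ C₁ C₂ q : ℝ) (μ : ℝ → ℝ) (r : ℝ) : ℝ :=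
  -muder R₀ L₀ C₁ C₂ q μ r + L₀ / (r * (r ^ 2 + L₀))

/-- A reduced static shell: `γ(R₀)=0`, `2m(r)/r<1` for `r ≥ R₀`, and the
field equation `μ'(r) = (m/r² + 4πrp)·(1-2m/r)⁻¹` for `r ≥ R₀`. -/
structure IsReducedShell (R₀ L₀ C₁ C₂ q : ℝ) (μ : ℝ → ℝ) : Prop where
  inner_zero : gam L₀ μ R₀ = 0
  mass_lt : ∀ r, R₀ ≤ r → 2 * mass R₀ L₀ C₁ q μ r / r < 1
  field_eq : ∀ r, R₀ ≤ r → HasDerivAt μ (muder R₀ L₀ C₁ C₂ q μ r) r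

/-- `σ* = C₀·R₀^(1 + (2q+1)/(q(q+1)))`. -/
def sigmaStar (C₀ R₀ q : ℝ) : ℝ := C₀ * R₀ ^ (1 + (2 * q + 1) / (q * (q + 1)))

/-- `γ* = σ*/(2(R₀ + σ*))`. -/
def gammaStar (C₀ R₀ q : ℝ) : ℝ :=
  sigmaStar C₀ R₀ q / (2 * (R₀ + sigmaStar C₀ R₀ q))

lemma gam_hasDerivAt {R L C₁ C₂ q : ℝ} {μ : ℝ → ℝ} (hR : 0 < R) (hL : 0 < L)
    (h : IsReducedShell R L C₁ C₂ q μ) {r : ℝ} (hr : R ≤ r) :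
    HasDerivAt (gam L μ) (gamder R L C₁ C₂ q μ r) r := by
  have hr0 : 0 < r := hR.trans_le hr
  have h1 := h.field_eq r hr
  have h2 : HasDerivAt (fun x : ℝ => x ^ 2) (2 * r) r := by
    simpa using hasDerivAt_pow 2 r
  have h3 : HasDerivAt (fun x : ℝ => 1 + L / x ^ 2) (-(L * (2 * r)) / (r ^ 2) ^ 2) r := by
    have := ((hasDerivAt_const r L).div h2 (by positivity)).const_add 1
    refine this.congr_deriv ?_
    ring
  have h4 := (h3.log (by positivity)).const_mul (1 / 2)
  have h5 := h1.neg.sub h4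
  refine h5.congr_deriv ?_
  unfold gamder
  field_simp
  ring

lemma gam_contOn {R L C₁ C₂ q : ℝ} {μ : ℝ → ℝ} (hR : 0 < R) (hL : 0 < L)
    (h : IsReducedShell R L C₁ C₂ q μ) : ContinuousOn (gam L μ) (Set.Ici R) :=
  fun _ hr => (gam_hasDerivAt hR hL h hr).continuousAt.continuousWithinAt

lemma rho_nonneg {L C₁ q : ℝ} {μ : ℝ → ℝ} (hC₁ : 0 < C₁) (r : ℝ) :
    0 ≤ 4 * π * r ^ 2 * rho L C₁ q μ r := by
  unfold rho
  have : 0 ≤ (max (gam L μ r) 0) ^ q := Real.rpow_nonneg (le_max_right _ _) _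
  positivity

lemma mass_nonneg' {R L C₁ q : ℝ} {μ : ℝ → ℝ} (hC₁ : 0 < C₁) {r : ℝ} (hr : R ≤ r) :
    0 ≤ mass R L C₁ q μ r :=
  intervalIntegral.integral_nonneg hr fun u _ => rho_nonneg hC₁ u

lemma rho_contOn {R L C₁ C₂ q : ℝ} {μ : ℝ → ℝ} (hR : 0 < R) (hL : 0 < L) (hq : 2 ≤ q)
    (h : IsReducedShell R L C₁ C₂ q μ) :
    ContinuousOn (fun r => 4 * π * r ^ 2 * rho L C₁ q μ r) (Set.Ici R) := by
  unfold rho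
  have hg := gam_contOn hR hL h
  have h1 : ContinuousOn (fun r => (max (gam L μ r) 0) ^ q) (Set.Ici R) :=
    (ContinuousOn.sup hg continuousOn_const).rpow_const fun x _ => Or.inr (by linarith)
  have h2 : ∀ x ∈ Set.Ici R, x ^ 4 ≠ 0 := fun x hx => by
    have : 0 < x := hR.trans_le hx
    positivity
  fun_prop (disch := assumption)

lemma muder_nonneg {R L C₁ C₂ q : ℝ} {μ : ℝ → ℝ} (hR : 0 < R) (hC₁ : 0 < C₁) (hC₂ : 0 < C₂)
    (h : IsReducedShell R L C₁ C₂ q μ) {r : ℝ} (hr : R ≤ r) :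
    0 ≤ muder R L C₁ C₂ q μ r := by
  have hr0 : 0 < r := hR.trans_le hr
  have h1 := h.mass_lt r hr
  have h2 := mass_nonneg' (L := L) (q := q) (μ := μ) hC₁ hr
  have h3 : 0 ≤ (max (gam L μ r) 0) ^ (q + 1) := Real.rpow_nonneg (le_max_right _ _) _
  unfold muder pres
  refine mul_nonneg (by positivity) (inv_nonneg.2 (by linarith))

lemma gam_upper {R L C₁ C₂ q : ℝ} {μ : ℝ → ℝ} (hR : 0 < R) (hL : 0 < L) (hC₁ : 0 < C₁)
    (hC₂ : 0 < C₂) (h : IsReducedShell R L C₁ C₂ q μ) {r : ℝ} (hr : R ≤ r) :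
    gam L μ r ≤ 1 / R * (r - R) := by
  have := (convex_Ici R).image_sub_le_mul_sub_of_deriv_le (f := gam L μ) (C := 1 / R)
    (gam_contOn hR hL h)
    (fun x hx => by
      rw [interior_Ici] at hx
      exact (gam_hasDerivAt hR hL h hx.le).differentiableAt.differentiableWithinAt)
    (fun x hx => by
      rw [interior_Ici] at hx
      have hx' : R ≤ x := le_of_lt hx
      have hx0 : 0 < x := hR.trans_le hx'
      rw [(gam_hasDerivAt hR hL h hx').deriv]
      have h1 := muder_nonneg hR hC₁ hC₂ h hx'
      have h2 : L / (x * (x ^ 2 + L)) ≤ 1 / R := by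
        rw [div_le_div_iff₀ (by positivity) hR]
        nlinarith [mul_le_mul_of_nonneg_left hx' hL.le, pow_pos hx0 3]
      unfold gamder
      linarith) R Set.self_mem_Ici r hr hr
  rw [h.inner_zero] at this
  linarith

/-- At `R + R g` the function `γ` is above `g / 2`. -/
lemma gam_lower {R L C₁ C₂ q g : ℝ} {μ : ℝ → ℝ} (hR : 0 < R) (hL : 0 < L) (hC₁ : 0 < C₁)
    (hC₂ : 0 < C₂) (hq : 2 ≤ q) (hg : 0 < g) (hg4 : g ≤ 1 / 4) (hRL : R ^ 2 ≤ L / 100)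
    (hG1 : 4 * π * C₁ * g ^ (q + 1) ≤ R ^ 2 / 16)
    (hG2 : 4 * π * C₂ * g ^ (q + 1) ≤ R ^ 2 / 16)
    (h : IsReducedShell R L C₁ C₂ q μ) : g / 2 < gam L μ (R + R * g) := by
  have hmax : ∀ r ∈ Set.Icc R (R + R * g), max (gam L μ r) 0 ≤ g := by
    intro r hr
    refine max_le ((gam_upper hR hL hC₁ hC₂ h hr.1).trans ?_) hg.le
    rw [one_div, inv_mul_le_iff₀ hR]
    linarith [hr.2]
  have hmass : ∀ r ∈ Set.Icc R (R + R * g), mass R L C₁ q μ r ≤ R / 16 := by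
    intro r hr
    have h1 : ‖∫ η in R..r, 4 * π * η ^ 2 * rho L C₁ q μ η‖ ≤ 4 * π * C₁ * g ^ q / R ^ 2 * |r - R| := by
      apply intervalIntegral.norm_integral_le_of_norm_le_const
      intro x hx
      rw [Set.uIoc_of_le hr.1] at hx
      have hx0 : 0 < x := hR.trans hx.1
      rw [Real.norm_of_nonneg (rho_nonneg hC₁ x)]
      have h2 : (max (gam L μ x) 0) ^ q ≤ g ^ q :=
        Real.rpow_le_rpow (le_max_right _ _) (hmax x ⟨hx.1.le, hx.2.trans hr.2⟩) (by linarith)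
      have h3 : 4 * π * x ^ 2 * rho L C₁ q μ x
          = 4 * π * C₁ * (max (gam L μ x) 0) ^ q / x ^ 2 := by
        unfold rho
        field_simp
      rw [h3]
      have := hx.1.le
      gcongr
    have h4 : |r - R| ≤ R * g := by
      rw [abs_of_nonneg (by linarith [hr.1])]
      linarith [hr.2]
    calc mass R L C₁ q μ r ≤ _ := le_abs_self _
      _ ≤ _ := h1
      _ ≤ 4 * π * C₁ * g ^ q / R ^ 2 * (R * g) := by gcongr
      _ = (4 * π * C₁ * g ^ (q + 1)) / R := by
          rw [Real.rpow_add_one hg.ne']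
          field_simp
      _ ≤ (R ^ 2 / 16) / R := by gcongr
      _ = R / 16 := by field_simp
  have hmu : ∀ r ∈ Set.Icc R (R + R * g), muder R L C₁ C₂ q μ r ≤ 1 / 7 * (1 / R) := by
    intro r hr
    have hr0 : 0 < r := hR.trans_le hr.1
    have hrR := hr.1
    have hm := hmass r hr
    have hm0 := mass_nonneg' (L := L) (q := q) (μ := μ) hC₁ hr.1
    have h1 : mass R L C₁ q μ r / r ^ 2 ≤ 1 / 16 * (1 / R) := by
      calc mass R L C₁ q μ r / r ^ 2 ≤ (R / 16) / R ^ 2 := by gcongr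
        _ = _ := by field_simp
    have h2 : 4 * π * r * pres L C₂ q μ r ≤ 1 / 16 * (1 / R) := by
      have h3 : (max (gam L μ r) 0) ^ (q + 1) ≤ g ^ (q + 1) :=
        Real.rpow_le_rpow (le_max_right _ _) (hmax r hr) (by linarith)
      calc 4 * π * r * pres L C₂ q μ r = 4 * π * C₂ * (max (gam L μ r) 0) ^ (q + 1) / r ^ 3 := by
            unfold pres
            field_simp
        _ ≤ 4 * π * C₂ * g ^ (q + 1) / R ^ 3 := by gcongr
        _ ≤ (R ^ 2 / 16) / R ^ 3 := by gcongr
        _ = _ := by field_simp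
    have h3 : 2 * mass R L C₁ q μ r / r ≤ 1 / 8 := by
      rw [div_le_iff₀ hr0]
      linarith
    have h4 : (1 - 2 * mass R L C₁ q μ r / r)⁻¹ ≤ 8 / 7 := by
      rw [inv_le_comm₀ (by linarith) (by norm_num)]
      linarith
    have hi : 0 < 1 / R := by positivity
    unfold muder
    calc _ ≤ (1 / 16 * (1 / R) + 1 / 16 * (1 / R)) * (8 / 7) :=
          mul_le_mul (add_le_add h1 h2) h4 (inv_nonneg.2 (by linarith)) (by positivity)
      _ = _ := by ring
  have hd : ∀ r ∈ Set.Icc R (R + R * g), 11 / 20 * (1 / R) ≤ gamder R L C₁ C₂ q μ r := by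
    intro r hr
    have hr0 : 0 < r := hR.trans_le hr.1
    have hr5 : r ≤ 5 / 4 * R := by nlinarith [hr.2]
    have h1 := hmu r hr
    have h2 : 7 / 10 * (1 / R) ≤ L / (r * (r ^ 2 + L)) := by
      rw [mul_one_div, div_le_div_iff₀ hR (by positivity)]
      have h3 : r ^ 2 ≤ L / 50 := by nlinarith
      have h4 : r * (r ^ 2 + L) ≤ 5 / 4 * R * (L / 50 + L) := by gcongr
      nlinarith [mul_pos hR hL]
    have hi : 0 < 1 / R := by positivity
    unfold gamder
    linarith
  have hRg : 0 < R * g := by positivity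
  have key := (convex_Icc R (R + R * g)).mul_sub_le_image_sub_of_le_deriv (f := gam L μ)
    (C := 11 / 20 * (1 / R))
    ((gam_contOn hR hL h).mono Set.Icc_subset_Ici_self)
    (fun x hx => by
      rw [interior_Icc] at hx
      exact (gam_hasDerivAt hR hL h hx.1.le).differentiableAt.differentiableWithinAt)
    (fun x hx => by
      rw [interior_Icc] at hx
      rw [(gam_hasDerivAt hR hL h hx.1.le).deriv]
      exact hd x ⟨hx.1.le, hx.2.le⟩) R (by constructor <;> linarith) (R + R * g)
      (by constructor <;> linarith) (by linarith)
  rw [h.inner_zero] at key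
  have e : 11 / 20 * (1 / R) * (R + R * g - R) = 11 / 20 * g := by field_simp; ring
  rw [e] at key
  linarith

/-- `γ` cannot stay above `s` for a long time. -/
lemma gam_drop {R L C₁ C₂ q g s y : ℝ} {μ : ℝ → ℝ} (hR : 0 < R) (hL : 0 < L) (hC₁ : 0 < C₁)
    (hq : 2 ≤ q) (hg : 0 < g) (hg4 : g ≤ 1 / 4) (hs : 0 < s)
    (hy : 0 < y) (hyR : y ≤ R) (hk : 9 * R ^ 3 ≤ C₁ * s ^ q * y)
    (h : IsReducedShell R L C₁ C₂ q μ) :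
    ∃ r ∈ Set.Icc (R + R * g) (R + R * g + y / 2), gam L μ r ≤ s := by
  by_contra! hcon
  have hRg : 0 < R * g := by positivity
  have hRg' : R * g ≤ R / 4 := by nlinarith
  have hcont := rho_contOn hR hL hq h
  have hint : ∀ a b, R ≤ a → a ≤ b →
      IntervalIntegrable (fun r => 4 * π * r ^ 2 * rho L C₁ q μ r) volume a b := by
    intro a b ha hab
    apply ContinuousOn.intervalIntegrable
    rw [Set.uIcc_of_le hab]
    exact hcont.mono fun x hx => ha.trans hx.1
  set a := R + R * g with ha
  set b := a + y / 2 with hb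
  have h1 : mass R L C₁ q μ b = mass R L C₁ q μ a +
      ∫ η in a..b, 4 * π * η ^ 2 * rho L C₁ q μ η := by
    unfold mass
    rw [intervalIntegral.integral_add_adjacent_intervals] <;> apply hint <;> linarith
  have h2 : ∫ η in a..b, (π * C₁ * s ^ q / R ^ 2) ≤ ∫ η in a..b, 4 * π * η ^ 2 * rho L C₁ q μ η := by
    apply intervalIntegral.integral_mono_on (by linarith) (by simp) (hint _ _ (by linarith) (by linarith))
    intro x hx
    have hxR : R ≤ x := by linarith [hx.1]
    have hx0 : 0 < x := by linarith
    have hx2 : x ≤ 2 * R := by linarith [hx.2]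
    have h3 : s ^ q ≤ (max (gam L μ x) 0) ^ q :=
      Real.rpow_le_rpow hs.le ((hcon x hx).le.trans (le_max_left _ _)) (by linarith)
    have h4 : 4 * π * x ^ 2 * rho L C₁ q μ x
        = 4 * π * C₁ * (max (gam L μ x) 0) ^ q / x ^ 2 := by
      unfold rho
      field_simp
    rw [h4]
    calc π * C₁ * s ^ q / R ^ 2 = 4 * π * C₁ * s ^ q / (2 * R) ^ 2 := by field_simp; norm_num
      _ ≤ _ := by gcongr
  rw [intervalIntegral.integral_const, smul_eq_mul] at h2
  have h5 : b - a = y / 2 := by rw [hb]; ring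
  rw [h5] at h2
  have h6 : 9 * π * R / 2 ≤ y / 2 * (π * C₁ * s ^ q / R ^ 2) := by
    have : y / 2 * (π * C₁ * s ^ q / R ^ 2) = π / (2 * R ^ 2) * (C₁ * s ^ q * y) := by
      field_simp
    rw [this]
    calc 9 * π * R / 2 = π / (2 * R ^ 2) * (9 * R ^ 3) := by field_simp
      _ ≤ _ := by gcongr
  have h7 := mass_nonneg' (R := R) (L := L) (q := q) (μ := μ) hC₁ (r := a) (by linarith)
  have h8 := h.mass_lt b (by linarith)
  rw [div_lt_one (by linarith)] at h8
  have h9 : R ≤ π * R := by nlinarith [Real.pi_gt_three]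
  linarith

lemma first_crossing {f : ℝ → ℝ} {a b s : ℝ} (hf : ContinuousOn f (Set.Icc a b)) (ha : s < f a)
    (h : ∃ r ∈ Set.Icc a b, f r ≤ s) :
    ∃ r, a < r ∧ r ≤ b ∧ f r = s ∧ ∀ x ∈ Set.Icc a r, s ≤ f x := by
  have hcl : IsCompact (Set.Icc a b ∩ f ⁻¹' Set.Iic s) :=
    isCompact_Icc.of_isClosed_subset (hf.preimage_isClosed_of_isClosed isClosed_Icc isClosed_Iic)
      Set.inter_subset_left
  obtain ⟨r, ⟨hr, hrs⟩, hmin⟩ := hcl.exists_isLeast (by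
    obtain ⟨r, hr, hrs⟩ := h
    exact ⟨r, hr, hrs⟩)
  have hrs' : f r ≤ s := hrs
  have har : a < r := lt_of_le_of_ne hr.1 (by rintro rfl; linarith)
  have hlt : ∀ x ∈ Set.Ico a r, s < f x := by
    intro x hx
    by_contra! hc
    exact absurd (hmin ⟨⟨hx.1, hx.2.le.trans hr.2⟩, hc⟩) (not_le.2 hx.2)
  have heq : f r = s := by
    obtain ⟨x, hx, hxs⟩ := intermediate_value_Icc' har.le
      (hf.mono (Set.Icc_subset_Icc_right hr.2)) ⟨hrs', ha.le⟩
    rcases hx.2.lt_or_eq with h1 | h1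
    · exact absurd hxs (hlt x ⟨hx.1, h1⟩).ne'
    · rw [← h1, hxs]
  refine ⟨r, har, hr.2, heq, fun x hx => ?_⟩
  rcases hx.2.lt_or_eq with h1 | h1
  · exact (hlt x ⟨hx.1, h1⟩).le
  · rw [h1, heq]

/-- Lemma 4 of the paper. With `C_m = max{1, C₁, 4πC₂}`,
`0 < C₀ ≤ min{1/4, 1/(C_m·8^(1/(q+1)))}`, `κ = 9·4^q/(C₁·C₀^q)` and
`Γ = max{C₀, κ}`: there is `δ₀ > 0` such that every reduced static shell
with `R₀ ≤ δ₀` and `R₀^(1/(q+1))·Γ ≤ 1` admits a point `r₂` with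
`R₀ + σ* < r₂ < R₀ + σ* + κ·R₀^((q+2)/(q+1))`, `γ(r₂) = γ*` and `γ ≥ γ*`
on `[R₀ + σ*, r₂]`. -/
theorem exists_second_crossing (L₀ C₁ C₂ q C₀ : ℝ)
    (hL₀ : 0 < L₀) (hC₁ : 0 < C₁) (hC₂ : 0 < C₂) (hq : 2 ≤ q)
    (hC₀ : 0 < C₀)
    (hC₀le : C₀ ≤ min (1 / 4)
      (1 / (max (max 1 C₁) (4 * π * C₂) * (8 : ℝ) ^ (1 / (q + 1))))) :
    ∃ δ₀ : ℝ, 0 < δ₀ ∧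
      ∀ (R₀ : ℝ) (μ : ℝ → ℝ), 0 < R₀ → R₀ ≤ δ₀ →
        R₀ ^ (1 / (q + 1)) *
          max C₀ (9 * (4 : ℝ) ^ q / (C₁ * C₀ ^ q)) ≤ 1 →
        IsReducedShell R₀ L₀ C₁ C₂ q μ →
        ∃ r₂ : ℝ,
          R₀ + sigmaStar C₀ R₀ q < r₂ ∧
          r₂ < R₀ + sigmaStar C₀ R₀ q +
                (9 * (4 : ℝ) ^ q / (C₁ * C₀ ^ q)) * R₀ ^ ((q + 2) / (q + 1)) ∧
          gam L₀ μ r₂ = gammaStar C₀ R₀ q ∧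
          ∀ r ∈ Set.Icc (R₀ + sigmaStar C₀ R₀ q) r₂,
            gammaStar C₀ R₀ q ≤ gam L₀ μ r := by
  have hC4 : C₀ ≤ 1 / 4 := hC₀le.trans (min_le_left _ _)
  have hq0 : 0 < q := by linarith
  have hpi := Real.pi_pos
  set t : ℝ := min (1 / (64 * π * C₁)) (1 / (64 * π * C₂)) with ht
  have ht0 : 0 < t := by rw [ht]; positivity
  refine ⟨min (t ^ q) (min 1 (L₀ / 100)), by positivity, ?_⟩
  intro R μ hR hRd hΓ h
  have hRt : R ≤ t ^ q := hRd.trans (min_le_left _ _)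
  have hR1 : R ≤ 1 := hRd.trans ((min_le_right _ _).trans (min_le_left _ _))
  have hRL' : R ≤ L₀ / 100 := hRd.trans ((min_le_right _ _).trans (min_le_right _ _))
  have hRL : R ^ 2 ≤ L₀ / 100 := by nlinarith
  set α := (2 * q + 1) / (q * (q + 1)) with hα
  have hα0 : 0 < α := by positivity
  set g := C₀ * R ^ α with hgdef
  have hg : 0 < g := by positivity
  have hRα : R ^ α ≤ 1 := Real.rpow_le_one hR.le hR1 hα0.le
  have hg4 : g ≤ 1 / 4 := by
    have := mul_le_mul hC4 hRα (by positivity) (by norm_num)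
    linarith
  have hσ : sigmaStar C₀ R q = R * g := by
    unfold sigmaStar
    rw [← hα, Real.rpow_add hR, Real.rpow_one, hgdef]
    ring
  have hγ : gammaStar C₀ R q = g / (2 * (1 + g)) := by
    unfold gammaStar
    rw [hσ]
    field_simp
  have hG : g ^ (q + 1) ≤ t * R ^ 2 := by
    rw [hgdef, Real.mul_rpow hC₀.le (by positivity), ← Real.rpow_mul hR.le]
    have e : α * (q + 1) = 1 / q + (2 : ℕ) := by
      rw [hα]; push_cast; field_simp; ring
    rw [e, Real.rpow_add hR, Real.rpow_natCast]
    have h1 : C₀ ^ (q + 1) ≤ 1 := Real.rpow_le_one hC₀.le (by linarith) (by linarith)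
    have h2 : R ^ (1 / q) ≤ t := by
      calc R ^ (1 / q) ≤ (t ^ q) ^ (1 / q) := Real.rpow_le_rpow hR.le hRt (by positivity)
        _ = t := by rw [← Real.rpow_mul ht0.le, mul_one_div_cancel hq0.ne', Real.rpow_one]
    calc C₀ ^ (q + 1) * (R ^ (1 / q) * R ^ 2) ≤ 1 * (t * R ^ 2) := by gcongr
      _ = _ := one_mul _
  have hG1 : 4 * π * C₁ * g ^ (q + 1) ≤ R ^ 2 / 16 := by
    calc 4 * π * C₁ * g ^ (q + 1) ≤ 4 * π * C₁ * (1 / (64 * π * C₁) * R ^ 2) := by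
          have := min_le_left (1 / (64 * π * C₁)) (1 / (64 * π * C₂))
          gcongr
          exact hG.trans (by gcongr)
      _ = _ := by field_simp; norm_num
  have hG2 : 4 * π * C₂ * g ^ (q + 1) ≤ R ^ 2 / 16 := by
    calc 4 * π * C₂ * g ^ (q + 1) ≤ 4 * π * C₂ * (1 / (64 * π * C₂) * R ^ 2) := by
          have := min_le_right (1 / (64 * π * C₁)) (1 / (64 * π * C₂))
          gcongr
          exact hG.trans (by gcongr)
      _ = _ := by field_simp; norm_num
  have hlow := gam_lower hR hL₀ hC₁ hC₂ hq hg hg4 hRL hG1 hG2 h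
  set s := gammaStar C₀ R q with hsdef
  have hs : 0 < s := by rw [hγ]; positivity
  have hsg : s ≤ g / 2 := by
    rw [hγ]
    gcongr
    linarith
  have hs4 : g ≤ 4 * s := by
    rw [hγ, ← mul_div_assoc, le_div_iff₀ (by positivity)]
    nlinarith
  set κ := 9 * (4 : ℝ) ^ q / (C₁ * C₀ ^ q) with hκ
  have hκ0 : 0 < κ := by positivity
  set y := κ * R ^ ((q + 2) / (q + 1)) with hy
  have hy0 : 0 < y := by positivity
  have hyR : y ≤ R := by
    have e : (q + 2) / (q + 1) = 1 + 1 / (q + 1) := by field_simp; ring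
    rw [hy, e, Real.rpow_add hR, Real.rpow_one]
    have h1 : R ^ (1 / (q + 1)) * κ ≤ 1 := le_trans (by gcongr; exact le_max_right _ _) hΓ
    calc κ * (R * R ^ (1 / (q + 1))) = R * (R ^ (1 / (q + 1)) * κ) := by ring
      _ ≤ R * 1 := by gcongr
      _ = R := mul_one _
  have hk : 9 * R ^ 3 ≤ C₁ * s ^ q * y := by
    have h1 : g ^ q ≤ 4 ^ q * s ^ q := by
      rw [← Real.mul_rpow (by norm_num) hs.le]
      exact Real.rpow_le_rpow hg.le hs4 hq0.le
    have h2 : g ^ q = C₀ ^ q * R ^ (α * q) := by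
      rw [hgdef, Real.mul_rpow hC₀.le (by positivity), ← Real.rpow_mul hR.le]
    have h3 : R ^ (α * q) * R ^ ((q + 2) / (q + 1)) = R ^ 3 := by
      rw [← Real.rpow_add hR, ← Real.rpow_natCast]
      congr 1
      rw [hα]; push_cast; field_simp; ring
    have h4 : C₁ * s ^ q * y = 9 * (4 ^ q * s ^ q) * R ^ ((q + 2) / (q + 1)) / C₀ ^ q := by
      rw [hy, hκ]; field_simp
    rw [h4]
    calc 9 * R ^ 3 = 9 * g ^ q * R ^ ((q + 2) / (q + 1)) / C₀ ^ q := by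
          rw [h2, ← h3]; field_simp
      _ ≤ _ := by gcongr
  rw [hσ]
  obtain ⟨r, hr1, hr2, hr3, hr4⟩ := first_crossing (f := gam L₀ μ) (s := s)
    ((gam_contOn hR hL₀ h).mono fun x hx => by
      have : 0 < R * g := by positivity
      exact (by linarith : R ≤ R + R * g).trans hx.1) (lt_of_le_of_lt hsg hlow)
    (gam_drop hR hL₀ hC₁ hq hg hg4 hs hy0 hyR hk h)
  exact ⟨r, hr1, by linarith, hr3, hr4⟩

end
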